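/- arXiv:2110.00744 — 2 statements merged into one kernel-verified Lean document; each statement's English description precedes it below -/
import Mathlib

section
/- Let n, k, L be positive integers with k ≤ n, let 0 ≤ p ≤ 1 and 0 < q < 1, let Q̄ be a set of unordered pairs of distinct elements of Fin n, and for each k-element subset K of Fin n let W_K = Q̄ ∩ {unordered pairs contained in K}. Assume |W_K| ≤ L for every k-element subset K. Define P₀ and P₁ on functions x : Q̄ → {0,1} by: under P₀ the coordinates are independent Bernoulli(q); under P₁ a k-element subset K is chosen uniformly at random and, given K, coordinates in W_K are independent Bernoulli(p) while the rest are independent Bernoulli(q). Then χ²(P₁,P₀) ≤ E[(1 + χ²(p||q))^{min(L, C(H,2))}] − 1, where H = |K₁ ∩ K₂| for K₁, K₂ independent uniformly random k-element subsets of Fin n, C(a,2) = a(a−1)/2, χ²(p||q) = (p−q)²/(q(1−q)), and χ²(P₁,P₀) = Σ_x P₁(x)²/P₀(x) − 1. -/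
open Finset Classical

/-- The unordered pairs of distinct elements of `Fin n`, encoded as ordered pairs `(i,j)`
with `i < j`. -/
abbrev Edge (n : ℕ) : Type := {e : Fin n × Fin n // e.1 < e.2}

/-- Per-coordinate likelihood-ratio second moment of Bernoulli mixtures. -/
lemma sum_bernoulli_mul_div (p q : ℝ) (hq0 : 0 < q) (hq1 : q < 1) (S T : Prop)
    [Decidable S] [Decidable T] :
    ∑ b : Bool, (if S then (if b then p else 1 - p) else (if b then q else 1 - q)) *
        (if T then (if b then p else 1 - p) else (if b then q else 1 - q)) /
        (if b then q else 1 - q)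
      = if S ∧ T then 1 + (p - q) ^ 2 / (q * (1 - q)) else 1 := by
  have h1 : q ≠ 0 := hq0.ne'
  have h2 : 1 - q ≠ 0 := (sub_pos.2 hq1).ne'
  by_cases hS : S <;> by_cases hT : T <;> simp [hS, hT] <;> field_simp <;> ring

lemma sum_prod_bernoulli_mul_div {ι : Type*} [Fintype ι] (p q : ℝ) (hq0 : 0 < q) (hq1 : q < 1)
    (S T : ι → Prop) [DecidablePred S] [DecidablePred T] :
    ∑ ω : ι → Bool,
        (∏ e, if S e then (if ω e then p else 1 - p) else (if ω e then q else 1 - q)) *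
        (∏ e, if T e then (if ω e then p else 1 - p) else (if ω e then q else 1 - q)) /
        (∏ e, if ω e then q else 1 - q)
      = (1 + (p - q) ^ 2 / (q * (1 - q))) ^ (univ.filter fun e => S e ∧ T e).card := by
  simp_rw [← Finset.prod_mul_distrib, ← Finset.prod_div_distrib]
  rw [← Fintype.prod_sum (fun (e : ι) (b : Bool) =>
    (if S e then (if b then p else 1 - p) else (if b then q else 1 - q)) *
        (if T e then (if b then p else 1 - p) else (if b then q else 1 - q)) /
        (if b then q else 1 - q))]
  simp_rw [sum_bernoulli_mul_div p q hq0 hq1]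
  rw [Finset.prod_ite, Finset.prod_const, Finset.prod_const_one, mul_one]

/-- A finite set of pairs contained in `A` has at most `C(|A|, 2)` elements. -/
lemma card_filter_edge_le_choose_two {n : ℕ} (Q : Finset (Edge n)) (A : Finset (Fin n)) :
    (Q.filter fun e => e.val.1 ∈ A ∧ e.val.2 ∈ A).card ≤ A.card.choose 2 := by
  rw [← Finset.card_powersetCard]
  refine Finset.card_le_card_of_injOn (fun e => {e.val.1, e.val.2}) ?_ ?_
  · intro e he
    have he' := (Finset.mem_filter.1 he).2
    simp only [Finset.mem_coe, Finset.mem_powersetCard]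
    refine ⟨?_, Finset.card_pair e.2.ne⟩
    simp [Finset.insert_subset_iff, he'.1, he'.2]
  · rintro ⟨⟨a, b⟩, hab⟩ - ⟨⟨c, d⟩, hcd⟩ - h
    have h' : ({a, b} : Finset (Fin n)) = {c, d} := h
    have ha : a ∈ ({c, d} : Finset (Fin n)) := h' ▸ (by simp)
    have hb : b ∈ ({c, d} : Finset (Fin n)) := h' ▸ (by simp)
    simp only [Finset.mem_insert, Finset.mem_singleton] at ha hb
    simp only at hab hcd
    simp only [Subtype.mk.injEq, Prod.mk.injEq]
    grind

lemma card_inter_pairs_le_min {n k L : ℕ} (Q : Finset (Edge n))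
    (hW : ∀ K ∈ Finset.powersetCard k (Finset.univ : Finset (Fin n)),
      (Q.filter (fun e => e.val.1 ∈ K ∧ e.val.2 ∈ K)).card ≤ L)
    {K₁ : Finset (Fin n)} (hK₁ : K₁ ∈ Finset.powersetCard k (Finset.univ : Finset (Fin n)))
    (K₂ : Finset (Fin n)) :
    (univ.filter fun e : {e : Edge n // e ∈ Q} =>
      (e.val.val.1 ∈ K₁ ∧ e.val.val.2 ∈ K₁) ∧ (e.val.val.1 ∈ K₂ ∧ e.val.val.2 ∈ K₂)).card
      ≤ min L ((K₁ ∩ K₂).card.choose 2) := by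
  refine le_min ((Finset.card_le_card_of_injOn Subtype.val ?_
    Subtype.val_injective.injOn).trans (hW K₁ hK₁))
    ((Finset.card_le_card_of_injOn Subtype.val ?_
      Subtype.val_injective.injOn).trans (card_filter_edge_le_choose_two Q (K₁ ∩ K₂)))
  all_goals
    rintro ⟨e, he⟩ h
    have h' := (Finset.mem_filter.1 h).2
    simp only [Finset.mem_coe, Finset.mem_filter, Finset.mem_inter]
    tauto

/-- Chi-square upper bound for query-based detection of a planted dense subgraph: with `Q̄`
a set of queried pairs, `W K = Q̄ ∩ {pairs inside K}` satisfying `|W K| ≤ L` for every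
`k`-subset `K`, `P₀` the product `Bernoulli(q)` distribution on `x : Q̄ → Bool`, and `P₁`
the uniform-`K` mixture with `Bernoulli(p)` coordinates on `W K` and `Bernoulli(q)`
elsewhere, one has `χ²(P₁,P₀) ≤ E[(1 + χ²(p‖q))^{min(L, C(H,2))}] − 1`, where
`H = |K₁ ∩ K₂|` for independent uniform `k`-subsets `K₁, K₂` and
`χ²(p‖q) = (p−q)²/(q(1−q))`. -/
theorem chi_square_query_upper_bound (n k L : ℕ) (hk : 0 < k) (hkn : k ≤ n) (hL : 0 < L)
    (p q : ℝ) (hp0 : 0 ≤ p) (hp1 : p ≤ 1) (hq0 : 0 < q) (hq1 : q < 1)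
    (Qbar : Finset (Edge n))
    (hW : ∀ K ∈ Finset.powersetCard k (Finset.univ : Finset (Fin n)),
      (Qbar.filter (fun e => e.val.1 ∈ K ∧ e.val.2 ∈ K)).card ≤ L) :
    (∑ ω : {e : Edge n // e ∈ Qbar} → Bool,
      (((n.choose k : ℝ))⁻¹ *
          ∑ K ∈ Finset.powersetCard k (Finset.univ : Finset (Fin n)),
            ∏ e : {e : Edge n // e ∈ Qbar},
              (if e.val.val.1 ∈ K ∧ e.val.val.2 ∈ K then (if ω e then p else 1 - p)
               else (if ω e then q else 1 - q))) ^ 2 /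
        (∏ e : {e : Edge n // e ∈ Qbar}, (if ω e then q else 1 - q))) - 1
    ≤ (((n.choose k : ℝ))⁻¹ ^ 2 *
        ∑ K₁ ∈ Finset.powersetCard k (Finset.univ : Finset (Fin n)),
          ∑ K₂ ∈ Finset.powersetCard k (Finset.univ : Finset (Fin n)),
            (1 + (p - q) ^ 2 / (q * (1 - q))) ^ (min L (((K₁ ∩ K₂).card).choose 2))) - 1 := by
  have hχ : 1 ≤ 1 + (p - q) ^ 2 / (q * (1 - q)) :=
    le_add_of_nonneg_right (div_nonneg (sq_nonneg _) (mul_pos hq0 (sub_pos.2 hq1)).le)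
  refine sub_le_sub_right ?_ 1
  simp_rw [mul_pow, mul_div_assoc]
  rw [← Finset.mul_sum]
  refine mul_le_mul_of_nonneg_left ?_ (sq_nonneg _)
  simp_rw [sq (∑ K ∈ _, _), Finset.sum_mul_sum, Finset.sum_div]
  rw [Finset.sum_comm]
  refine Finset.sum_le_sum fun K₁ hK₁ => ?_
  rw [Finset.sum_comm]
  refine Finset.sum_le_sum fun K₂ _ => ?_
  calc _ = _ := by
        convert sum_prod_bernoulli_mul_div p q hq0 hq1
          (fun e : {e : Edge n // e ∈ Qbar} => e.val.val.1 ∈ K₁ ∧ e.val.val.2 ∈ K₁)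
          (fun e : {e : Edge n // e ∈ Qbar} => e.val.val.1 ∈ K₂ ∧ e.val.val.2 ∈ K₂)
    _ ≤ _ := by
        refine pow_le_pow_right₀ hχ ?_
        convert card_inter_pairs_le_min Qbar hW hK₁ K₂
end

section
/- Let n, k be positive integers with k ≤ n, let 0 ≤ p ≤ 1 and 0 < q < 1, let Q̄ be a set of unordered pairs of distinct elements of Fin n, and define the distributions P₀ and P₁ on functions x : Q̄ → {0,1} by: under P₀ the coordinates are independent Bernoulli(q); under P₁ a k-element subset K of Fin n is chosen uniformly at random and, given K, the coordinates indexed by pairs contained in K are independent Bernoulli(p) while the remaining coordinates are independent Bernoulli(q). Then for every test φ : ({0,1}^{Q̄}) → {0,1}, the risk satisfies P₀(φ = 1) + P₁(φ = 0) ≥ 1 − √((E[(1 + χ²(p||q))^{N(K₁,K₂)}] − 1)/2), where K₁, K₂ are independent uniformly random k-element subsets of Fin n, N(K₁,K₂) is the number of pairs in Q̄ contained in both K₁ and K₂, and χ²(p||q) = (p−q)²/(q(1−q)). -/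
open Finset Classical

/-- The null distribution `P₀` on query responses `ω : Q̄ → Bool`: independent
`Bernoulli(q)` coordinates. -/
noncomputable def nullProb (n : ℕ) (Qbar : Finset (Edge n)) (q : ℝ)
    (ω : {e : Edge n // e ∈ Qbar} → Bool) : ℝ :=
  ∏ e : {e : Edge n // e ∈ Qbar}, (if ω e then q else 1 - q)

/-- The planted distribution `P₁` on query responses `ω : Q̄ → Bool`: a `k`-element subset
`K` of `Fin n` is chosen uniformly at random; coordinates indexed by pairs contained in `K`
are independent `Bernoulli(p)` and the remaining coordinates are independent
`Bernoulli(q)`. -/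
noncomputable def plantedProb (n k : ℕ) (Qbar : Finset (Edge n)) (p q : ℝ)
    (ω : {e : Edge n // e ∈ Qbar} → Bool) : ℝ :=
  ((n.choose k : ℝ))⁻¹ *
    ∑ K ∈ Finset.powersetCard k (Finset.univ : Finset (Fin n)),
      ∏ e : {e : Edge n // e ∈ Qbar},
        (if e.val.val.1 ∈ K ∧ e.val.val.2 ∈ K then (if ω e then p else 1 - p)
         else (if ω e then q else 1 - q))

/-- Summing a product of coordinatewise functions over all response vectors factorizes. -/
lemma sum_bool_pi_prod {ι : Type*} [Fintype ι] [DecidableEq ι] (f : ι → Bool → ℝ) :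
    ∑ ω : ι → Bool, ∏ e, f e (ω e) = ∏ e, (f e true + f e false) := by
  rw [← Fintype.piFinset_univ, ← Finset.prod_univ_sum]
  simp

/-- The risk of a test is bounded below via the total variation distance, which is in turn
bounded through the chi-square divergence `∑ Q² / P - 1`. -/
lemma risk_ge_one_sub_sqrt_chi_sq {Ω : Type*} [Fintype Ω] (P Q : Ω → ℝ)
    (hP : ∀ ω, 0 < P ω) (hP1 : ∑ ω, P ω = 1) (hQ1 : ∑ ω, Q ω = 1) (φ : Ω → Bool) :
    1 - √((∑ ω, Q ω ^ 2 / P ω - 1) / 2) ≤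
      (∑ ω, if φ ω = true then P ω else 0) + ∑ ω, if φ ω = false then Q ω else 0 := by
  set R := (∑ ω, if φ ω = true then P ω else 0) + ∑ ω, if φ ω = false then Q ω else 0 with hR
  have hχ : ∑ ω, (P ω - Q ω) ^ 2 / P ω = ∑ ω, Q ω ^ 2 / P ω - 1 := by
    have h : ∀ ω, (P ω - Q ω) ^ 2 / P ω = P ω - 2 * Q ω + Q ω ^ 2 / P ω := fun ω => by
      have := (hP ω).ne'
      field_simp
      ring
    simp only [h, Finset.sum_add_distrib, Finset.sum_sub_distrib, ← Finset.mul_sum, hP1, hQ1]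
    ring
  have hS : 2 * (1 - R) = ∑ ω, (if φ ω = false then (1 : ℝ) else -1) * (P ω - Q ω) := by
    have h : ∀ ω, (if φ ω = false then (1 : ℝ) else -1) * (P ω - Q ω) =
        P ω + Q ω - 2 * ((if φ ω = true then P ω else 0) + if φ ω = false then Q ω else 0) :=
      fun ω => by cases φ ω <;> simp <;> ring
    simp only [h, Finset.sum_add_distrib, Finset.sum_sub_distrib, ← Finset.mul_sum, hP1, hQ1]
    rw [← hR]
    ring
  have hCS := Finset.sum_sq_le_sum_mul_sum_of_sq_le_mul Finset.univ
    (r := fun ω => (if φ ω = false then (1 : ℝ) else -1) * (P ω - Q ω))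
    (f := P) (g := fun ω => (P ω - Q ω) ^ 2 / P ω) (fun ω _ => (hP ω).le)
    (fun ω _ => div_nonneg (sq_nonneg _) (hP ω).le)
    (fun ω _ => le_of_eq <| by
      have := (hP ω).ne'
      field_simp
      cases φ ω <;> simp)
  rw [← hS, hP1, one_mul, hχ] at hCS
  have : 1 - R ≤ √((∑ ω, Q ω ^ 2 / P ω - 1) / 2) :=
    Real.le_sqrt_of_sq_le (by nlinarith [sq_nonneg (1 - R)])
  linarith

lemma nullProb_pos {n : ℕ} (Qbar : Finset (Edge n)) {q : ℝ} (hq0 : 0 < q) (hq1 : q < 1)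
    (ω : {e : Edge n // e ∈ Qbar} → Bool) : 0 < nullProb n Qbar q ω :=
  Finset.prod_pos fun e _ => by
    split_ifs
    · exact hq0
    · linarith

lemma sum_nullProb {n : ℕ} (Qbar : Finset (Edge n)) (q : ℝ) :
    ∑ ω, nullProb n Qbar q ω = 1 := by
  unfold nullProb
  rw [sum_bool_pi_prod (fun _ b => if b then q else 1 - q)]
  simp

lemma sum_plantedProb {n k : ℕ} (hkn : k ≤ n) (Qbar : Finset (Edge n)) (p q : ℝ) :
    ∑ ω, plantedProb n k Qbar p q ω = 1 := by
  have hc : (n.choose k : ℝ) ≠ 0 := by exact_mod_cast (Nat.choose_pos hkn).ne'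
  unfold plantedProb
  rw [← Finset.mul_sum, Finset.sum_comm]
  have h : ∀ K ∈ Finset.powersetCard k (Finset.univ : Finset (Fin n)),
      ∑ ω : {e : Edge n // e ∈ Qbar} → Bool, ∏ e : {e : Edge n // e ∈ Qbar},
        (if e.val.val.1 ∈ K ∧ e.val.val.2 ∈ K then (if ω e then p else 1 - p)
         else (if ω e then q else 1 - q)) = 1 := fun K _ => by
    rw [sum_bool_pi_prod (fun (e : {e : Edge n // e ∈ Qbar}) b =>
      if e.val.val.1 ∈ K ∧ e.val.val.2 ∈ K then
      (if b then p else 1 - p) else (if b then q else 1 - q))]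
    refine Finset.prod_eq_one fun e _ => ?_
    split_ifs <;> simp_all
  rw [Finset.sum_congr rfl h]
  simp [hc]

/-- The chi-square identity: the second moment of the likelihood ratio under the null is the
expectation of `(1 + χ²(p‖q)) ^ N(K₁, K₂)`. -/
lemma sum_plantedProb_sq_div_nullProb {n k : ℕ} (Qbar : Finset (Edge n)) {p q : ℝ}
    (hq0 : 0 < q) (hq1 : q < 1) :
    ∑ ω, plantedProb n k Qbar p q ω ^ 2 / nullProb n Qbar q ω =
      ((n.choose k : ℝ))⁻¹ ^ 2 *
        ∑ K₁ ∈ Finset.powersetCard k (Finset.univ : Finset (Fin n)),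
          ∑ K₂ ∈ Finset.powersetCard k (Finset.univ : Finset (Fin n)),
            (1 + (p - q) ^ 2 / (q * (1 - q))) ^
              ((Qbar.filter (fun e =>
                (e.val.1 ∈ K₁ ∧ e.val.2 ∈ K₁) ∧ (e.val.1 ∈ K₂ ∧ e.val.2 ∈ K₂))).card) := by
  have hq : q ≠ 0 := hq0.ne'
  have hq' : 1 - q ≠ 0 := by linarith
  unfold plantedProb nullProb
  simp only [mul_pow, mul_div_assoc, ← Finset.mul_sum]
  congr 1
  simp only [sq (Finset.sum _ _), Finset.sum_mul_sum, Finset.sum_div, ← Finset.prod_mul_distrib,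
    ← Finset.prod_div_distrib]
  rw [Finset.sum_comm]
  refine Finset.sum_congr rfl fun K₁ _ => ?_
  rw [Finset.sum_comm]
  refine Finset.sum_congr rfl fun K₂ _ => ?_
  rw [sum_bool_pi_prod (fun (e : {e : Edge n // e ∈ Qbar}) b =>
    (if e.val.val.1 ∈ K₁ ∧ e.val.val.2 ∈ K₁ then (if b then p else 1 - p)
      else (if b then q else 1 - q)) *
    (if e.val.val.1 ∈ K₂ ∧ e.val.val.2 ∈ K₂ then (if b then p else 1 - p)
      else (if b then q else 1 - q)) / (if b then q else 1 - q)),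
    ← Finset.prod_const, Finset.prod_filter, ← Finset.prod_coe_sort Qbar]
  refine Finset.prod_congr rfl fun e _ => ?_
  by_cases h₁ : e.val.val.1 ∈ K₁ ∧ e.val.val.2 ∈ K₁ <;>
    by_cases h₂ : e.val.val.1 ∈ K₂ ∧ e.val.val.2 ∈ K₂ <;>
    simp only [h₁, h₂, and_self, and_true, and_false, if_true, if_false,
      Bool.false_eq_true] <;> field_simp <;> ring

/-- Non-adaptive detection lower bound: for any fixed query set `Q̄` and any test `φ`, the
risk satisfies
`P₀(φ = 1) + P₁(φ = 0) ≥ 1 − √((E[(1 + χ²(p‖q))^{N(K₁,K₂)}] − 1)/2)`,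
where `K₁, K₂` are independent uniform `k`-subsets of `Fin n`, `N(K₁,K₂)` is the number of
queried pairs contained in both `K₁` and `K₂`, and `χ²(p‖q) = (p−q)²/(q(1−q))`. -/
theorem query_detection_risk_lower_bound (n k : ℕ) (hk : 0 < k) (hkn : k ≤ n)
    (p q : ℝ) (hp0 : 0 ≤ p) (hp1 : p ≤ 1) (hq0 : 0 < q) (hq1 : q < 1)
    (Qbar : Finset (Edge n))
    (φ : ({e : Edge n // e ∈ Qbar} → Bool) → Bool) :
    1 - Real.sqrt
        (((((n.choose k : ℝ))⁻¹ ^ 2 *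
            ∑ K₁ ∈ Finset.powersetCard k (Finset.univ : Finset (Fin n)),
              ∑ K₂ ∈ Finset.powersetCard k (Finset.univ : Finset (Fin n)),
                (1 + (p - q) ^ 2 / (q * (1 - q))) ^
                  ((Qbar.filter (fun e =>
                      (e.val.1 ∈ K₁ ∧ e.val.2 ∈ K₁) ∧ (e.val.1 ∈ K₂ ∧ e.val.2 ∈ K₂))).card))
          - 1) / 2)
      ≤ (∑ ω : {e : Edge n // e ∈ Qbar} → Bool,
            if φ ω = true then nullProb n Qbar q ω else 0) +
        (∑ ω : {e : Edge n // e ∈ Qbar} → Bool,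
            if φ ω = false then plantedProb n k Qbar p q ω else 0) := by
  rw [← sum_plantedProb_sq_div_nullProb Qbar hq0 hq1]
  exact risk_ge_one_sub_sqrt_chi_sq _ _ (nullProb_pos Qbar hq0 hq1) (sum_nullProb Qbar q)
    (sum_plantedProb hkn Qbar p q) φ
end
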